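/- arXiv:2604.21376 — 5 statements merged into one kernel-verified Lean document; each statement's English description precedes it below -/
import Mathlib

section
/- Let V be a nonempty type and let Eb and Er be binary relations on V (the blue and red edge relations of a two-colored directed graph). Assume that the asymmetric part of the transitive closure of Eb admits no infinite walk, and that the asymmetric part of the transitive closure of Er admits no infinite walk. Then there exists a set S ⊆ V that is M-independent and such that every vertex x ∉ S satisfies M x s for some s ∈ S (i.e., there is a monochromatic path from x to a vertex of S). -/
/-- The asymmetric part of a binary relation. -/
def Asym {V : Type*} (R : V → V → Prop) : V → V → Prop :=
  fun x y => R x y ∧ ¬ R y x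

/-- `f` is an infinite (outward) walk for `R`. -/
def InfWalk {V : Type*} (R : V → V → Prop) (f : ℕ → V) : Prop :=
  ∀ n : ℕ, R (f n) (f (n + 1))

/-- The monochromatic relation: union of the two transitive closures. -/
def Mono {V : Type*} (Eb Er : V → V → Prop) : V → V → Prop :=
  fun x y => Relation.TransGen Eb x y ∨ Relation.TransGen Er x y

/-- `S` is `R`-independent. -/
def Indep {V : Type*} (R : V → V → Prop) (S : Set V) : Prop :=
  ∀ x ∈ S, ∀ y ∈ S, x = y ∨ ¬ R x y

/-- The order `≤_R` on subsets induced by a relation `R`. -/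
def leR {V : Type*} (R : V → V → Prop) (S T : Set V) : Prop :=
  ∀ s ∈ S, ∃ t ∈ T, s = t ∨ R s t

/-- The collection `𝒮` of nonempty `M`-independent sets `S` such that every
vertex reachable from `S` by a red path reaches `S` by a monochromatic path. -/
def Scal {V : Type*} (Eb Er : V → V → Prop) : Set (Set V) :=
  {S | S.Nonempty ∧ Indep (Mono Eb Er) S ∧
    ∀ y : V, (∃ s ∈ S, Relation.TransGen Er s y) → ∃ s' ∈ S, Mono Eb Er y s'}

/-- The set `S^∞_𝒞` associated to a collection `𝒞` of subsets. -/
def Sinf {V : Type*} (Eb : V → V → Prop) (C : Set (Set V)) : Set V :=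
  {s | ∃ S ∈ C, ∀ U ∈ C, leR (Asym (Relation.TransGen Eb)) S U → s ∈ U}

theorem wellFounded_flip_of_not_infWalk {V : Type*} {R : V → V → Prop}
    (h : ¬ ∃ f : ℕ → V, InfWalk R f) : WellFounded (flip R) := by
  rw [wellFounded_iff_isEmpty_descending_chain]
  exact ⟨fun f => h ⟨f.1, f.2⟩⟩

theorem exists_maximal_of_not_infWalk {V : Type*} {R : V → V → Prop}
    (h : ¬ ∃ f : ℕ → V, InfWalk R f) {X : Set V} (hX : X.Nonempty) :
    ∃ v ∈ X, ∀ y ∈ X, ¬ R v y := by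
  obtain ⟨v, hv, hmax⟩ := (wellFounded_flip_of_not_infWalk h).has_min X hX
  exact ⟨v, hv, hmax⟩

theorem Asym.trans {V : Type*} {R : V → V → Prop} (hR : ∀ {x y z}, R x y → R y z → R x z)
    {x y z : V} (hxy : Asym R x y) (hyz : Asym R y z) : Asym R x z :=
  ⟨hR hxy.1 hyz.1, fun hzx => hxy.2 (hR hyz.1 hzx)⟩

theorem leR_refl {V : Type*} (R : V → V → Prop) (S : Set V) : leR R S S :=
  fun s hs => ⟨s, hs, Or.inl rfl⟩

theorem leR.trans {V : Type*} {R : V → V → Prop} (hR : ∀ {x y z}, R x y → R y z → R x z)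
    {S T U : Set V} (hST : leR R S T) (hTU : leR R T U) : leR R S U := by
  intro s hs
  obtain ⟨t, ht, hst⟩ := hST s hs
  obtain ⟨u, hu, htu⟩ := hTU t ht
  refine ⟨u, hu, ?_⟩
  rcases hst with rfl | hst
  · exact htu
  · rcases htu with rfl | htu
    · exact Or.inr hst
    · exact Or.inr (hR hst htu)

theorem asym_transGen_trans {V : Type*} {E : V → V → Prop} {x y z : V}
    (hxy : Asym (Relation.TransGen E) x y) (hyz : Asym (Relation.TransGen E) y z) :
    Asym (Relation.TransGen E) x z :=
  Asym.trans Relation.TransGen.trans hxy hyz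

/-- `Sinf` is an upper bound of every collection of sets. -/
theorem leR_Sinf {V : Type*} {Eb : V → V → Prop}
    (hb : ¬ ∃ f : ℕ → V, InfWalk (Asym (Relation.TransGen Eb)) f)
    {C : Set (Set V)} {S : Set V} (hS : S ∈ C) :
    leR (Asym (Relation.TransGen Eb)) S (Sinf Eb C) := by
  intro s hs
  obtain ⟨t, ⟨hst, T, hT, hST, htT⟩, hmax⟩ := exists_maximal_of_not_infWalk hb
    (X := {t | (s = t ∨ Asym (Relation.TransGen Eb) s t) ∧
      ∃ T ∈ C, leR (Asym (Relation.TransGen Eb)) S T ∧ t ∈ T})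
    ⟨s, Or.inl rfl, S, hS, leR_refl _ S, hs⟩
  refine ⟨t, ⟨T, hT, fun U hU hTU => ?_⟩, hst⟩
  obtain ⟨u, hu, htu⟩ := hTU t htT
  rcases htu with rfl | htu
  · exact hu
  · refine absurd htu (hmax u ⟨Or.inr ?_, U, hU, hST.trans asym_transGen_trans hTU, hu⟩)
    rcases hst with rfl | hst
    · exact htu
    · exact asym_transGen_trans hst htu

theorem Indep.eq_of_rel {V : Type*} {R : V → V → Prop} {S : Set V} (hS : Indep R S)
    {x y : V} (hx : x ∈ S) (hy : y ∈ S) (h : R x y) : x = y :=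
  (hS x hx y hy).resolve_right (not_not_intro h)

/-- `Scal` is closed under `Sinf` of nonempty chains. -/
theorem Sinf_mem_Scal {V : Type*} {Eb Er : V → V → Prop}
    (hb : ¬ ∃ f : ℕ → V, InfWalk (Asym (Relation.TransGen Eb)) f)
    {C : Set (Set V)} (hC : C ⊆ Scal Eb Er) (hne : C.Nonempty)
    (hchain : ∀ S ∈ C, ∀ T ∈ C, leR (Asym (Relation.TransGen Eb)) S T ∨
      leR (Asym (Relation.TransGen Eb)) T S) :
    Sinf Eb C ∈ Scal Eb Er := by
  refine ⟨?_, ?_, ?_⟩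
  · obtain ⟨S, hS⟩ := hne
    obtain ⟨s, hs⟩ := (hC hS).1
    obtain ⟨t, ht, -⟩ := leR_Sinf hb hS s hs
    exact ⟨t, ht⟩
  · rintro s ⟨S, hS, hsS⟩ t ⟨T, hT, htT⟩
    rcases hchain S hS T hT with h | h
    · exact (hC hT).2.1 s (hsS T hT h) t (htT T hT (leR_refl _ T))
    · exact (hC hS).2.1 s (hsS S hS (leR_refl _ S)) t (htT S hS h)
  · rintro y ⟨s, ⟨S, hS, hsS⟩, hsy⟩
    have hs : s ∈ S := hsS S hS (leR_refl _ S)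
    obtain ⟨s', hs', hys'⟩ := (hC hS).2.2 y ⟨s, hs, hsy⟩
    rcases hys' with hys' | hys'
    · obtain ⟨t, ht, hst⟩ := leR_Sinf hb hS s' hs'
      refine ⟨t, ht, Or.inl ?_⟩
      rcases hst with rfl | hst
      · exact hys'
      · exact hys'.trans hst.1
    · obtain rfl := (hC hS).2.1.eq_of_rel hs hs' (Or.inr (hsy.trans hys'))
      exact ⟨s, ⟨S, hS, hsS⟩, Or.inr hys'⟩

theorem Scal_nonempty {V : Type*} [Nonempty V] (Eb : V → V → Prop) {Er : V → V → Prop}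
    (hr : ¬ ∃ f : ℕ → V, InfWalk (Asym (Relation.TransGen Er)) f) :
    (Scal Eb Er).Nonempty := by
  obtain ⟨v, -, hv⟩ := exists_maximal_of_not_infWalk hr (Set.univ_nonempty (α := V))
  refine ⟨{v}, Set.singleton_nonempty v, ?_, ?_⟩
  · rintro x rfl y rfl
    exact Or.inl rfl
  · rintro y ⟨s, rfl, hsy⟩
    exact ⟨s, rfl, Or.inr (by_contra fun h => hv y trivial ⟨hsy, h⟩)⟩

theorem exists_maximal_Scal {V : Type*} [Nonempty V] {Eb Er : V → V → Prop}
    (hb : ¬ ∃ f : ℕ → V, InfWalk (Asym (Relation.TransGen Eb)) f)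
    (hr : ¬ ∃ f : ℕ → V, InfWalk (Asym (Relation.TransGen Er)) f) :
    ∃ S ∈ Scal Eb Er, ∀ T ∈ Scal Eb Er, leR (Asym (Relation.TransGen Eb)) S T →
      leR (Asym (Relation.TransGen Eb)) T S := by
  have : Nonempty (Scal Eb Er) := (Scal_nonempty Eb hr).to_subtype
  obtain ⟨⟨S, hS⟩, hmax⟩ := exists_maximal_of_nonempty_chains_bounded
    (r := fun S T : Scal Eb Er => leR (Asym (Relation.TransGen Eb)) S.1 T.1)
    (fun c hc hne => by
      refine ⟨⟨Sinf Eb (Subtype.val '' c), Sinf_mem_Scal hb ?_ (hne.image _) ?_⟩,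
        fun S hS => leR_Sinf hb ⟨S, hS, rfl⟩⟩
      · rintro _ ⟨S, -, rfl⟩
        exact S.2
      · rintro _ ⟨S, hS, rfl⟩ _ ⟨T, hT, rfl⟩
        by_cases h : S = T
        · exact Or.inl (h ▸ leR_refl _ _)
        · exact hc hS hT h)
    (fun h₁ h₂ => h₁.trans asym_transGen_trans h₂)
  exact ⟨S, hS, fun T hT => hmax ⟨T, hT⟩⟩

/-- A vertex that does not reach `S`, and is red-maximal among such vertices, can be exchanged
for the vertices of `S` that reach it by a blue path. -/
theorem exchange_mem_Scal {V : Type*} {Eb Er : V → V → Prop} {S : Set V}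
    (hS : S ∈ Scal Eb Er) {v : V} (hvS : v ∉ S) (hv : ∀ s ∈ S, ¬ Mono Eb Er v s)
    (hmax : ∀ y, y ∉ S → (∀ s ∈ S, ¬ Mono Eb Er y s) → ¬ Asym (Relation.TransGen Er) v y) :
    insert v {s ∈ S | ¬ Relation.TransGen Eb s v} ∈ Scal Eb Er := by
  obtain ⟨-, hind, hred⟩ := hS
  refine ⟨⟨v, Or.inl rfl⟩, ?_, ?_⟩
  · rintro x (rfl | ⟨hx, hxv⟩) y (rfl | ⟨hy, hyv⟩)
    · exact Or.inl rfl
    · exact Or.inr (hv y hy)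
    · refine Or.inr ?_
      rintro (h | h)
      · exact hxv h
      · obtain ⟨s, hs, hys⟩ := hred y ⟨x, hx, h⟩
        exact hv s hs hys
    · exact hind x hx y hy
  · have key : ∀ y, ∀ s ∈ S, Mono Eb Er y s →
        (Relation.TransGen Er y s → ¬ Relation.TransGen Eb s v) →
        ∃ t ∈ insert v {s ∈ S | ¬ Relation.TransGen Eb s v}, Mono Eb Er y t := by
      intro y s hs hys h
      by_cases hsv : Relation.TransGen Eb s v
      · rcases hys with hys | hys
        · exact ⟨v, Or.inl rfl, Or.inl (hys.trans hsv)⟩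
        · exact absurd hsv (h hys)
      · exact ⟨s, Or.inr ⟨hs, hsv⟩, hys⟩
    rintro y ⟨x, rfl | ⟨hx, hxv⟩, hxy⟩
    · by_cases hy : ∃ s ∈ S, Mono Eb Er y s
      · obtain ⟨s, hs, hys⟩ := hy
        exact key y s hs hys fun h => absurd (Or.inr (hxy.trans h)) (hv s hs)
      · push Not at hy
        have hyS : y ∉ S := fun h => hv y h (Or.inr hxy)
        exact ⟨x, Or.inl rfl, Or.inr (by_contra fun h => hmax y hyS hy ⟨hxy, h⟩)⟩
    · obtain ⟨s, hs, hys⟩ := hred y ⟨x, hx, hxy⟩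
      refine key y s hs hys fun h => ?_
      rwa [← hind.eq_of_rel hx hs (Or.inr (hxy.trans h))]

theorem stmt0 {V : Type*} [Nonempty V] (Eb Er : V → V → Prop)
    (hb : ¬ ∃ f : ℕ → V, InfWalk (Asym (Relation.TransGen Eb)) f)
    (hr : ¬ ∃ f : ℕ → V, InfWalk (Asym (Relation.TransGen Er)) f) :
    ∃ S : Set V, Indep (Mono Eb Er) S ∧
      ∀ x : V, x ∉ S → ∃ s ∈ S, Mono Eb Er x s := by
  obtain ⟨S, hS, hmax⟩ := exists_maximal_Scal hb hr
  refine ⟨S, hS.2.1, ?_⟩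
  by_contra! hX
  obtain ⟨v, ⟨hvS, hv⟩, hvmax⟩ := exists_maximal_of_not_infWalk hr
    (X := {x | x ∉ S ∧ ∀ s ∈ S, ¬ Mono Eb Er x s}) hX
  have hT := exchange_mem_Scal hS hvS hv fun y hyS hy => hvmax y ⟨hyS, hy⟩
  obtain ⟨s, hs, hvs⟩ := hmax _ hT (fun s hs => by
    by_cases hsv : Relation.TransGen Eb s v
    · exact ⟨v, Or.inl rfl, Or.inr ⟨hsv, fun h => hv s hs (Or.inl h)⟩⟩
    · exact ⟨s, Or.inr ⟨hs, hsv⟩, Or.inl rfl⟩) v (Or.inl rfl)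
  rcases hvs with rfl | hvs
  · exact hvS hs
  · exact hv s hs (Or.inl hvs.1)
end

section
/- Let R be a binary relation on a type V. If there exists an infinite path for the asymmetric part of the transitive closure of R (i.e., an injective f : ℕ → V with Asym (R⁺) (f n) (f (n+1)) for all n), then there exists an infinite path for R itself (an injective g : ℕ → V with R (g n) (g (n+1)) for all n). -/
open Relation

/-- `Escapes R A k x`: within `k` steps of `R` through `A`, one can leave the strongly connected
component of `x`. -/
def Escapes {V : Type*} (R : V → V → Prop) (A : V → Prop) : ℕ → V → Prop
  | 0, _ => False
  | k + 1, x => ∃ y, R x y ∧ A y ∧ (ReflTransGen R y x → Escapes R A k y)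

theorem exists_escapes {V : Type*} {R : V → V → Prop} {A : V → Prop}
    (hA : ∀ x y, R x y → A y → A x) {x z : V} (hz : A z) (hxz : TransGen R x z)
    (hzx : ¬ ReflTransGen R z x) : ∃ k, Escapes R A k x := by
  have key : A x ∧ (¬ ReflTransGen R z x → ∃ k, Escapes R A k x) := by
    clear hzx
    induction hxz using TransGen.head_induction_on with
    | single h => exact ⟨hA _ _ h hz, fun hn => ⟨1, z, h, hz, fun h' => (hn h').elim⟩⟩
    | @head a c h _ ih =>
      refine ⟨hA _ _ h ih.1, fun hn => ?_⟩
      by_cases hca : ReflTransGen R c a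
      · obtain ⟨k, hk⟩ := ih.2 fun hzc => hn (hzc.trans hca)
        exact ⟨k + 1, c, h, ih.1, fun _ => hk⟩
      · exact ⟨1, c, h, ih.1, fun h' => (hca h').elim⟩
  exact key.2 hzx

/-- A walk along which a rank drops at every step that can be undone visits no vertex twice. -/
theorem InfWalk.injective_of_rank {V : Type*} {R : V → V → Prop} {g : ℕ → V} (hg : InfWalk R g)
    (d : V → ℕ) (hd : ∀ n, ReflTransGen R (g (n + 1)) (g n) → d (g (n + 1)) < d (g n)) :
    Function.Injective g := by
  have reach : ∀ m n, m ≤ n → ReflTransGen R (g m) (g n) := fun m n hmn =>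
    Nat.le_induction .refl (fun k _ ih => ih.tail (hg k)) n hmn
  refine Function.Injective.of_lt_imp_ne fun i j hij heq => ?_
  have drop : ∀ m, i ≤ m → m < j → d (g (m + 1)) < d (g m) := fun m him hmj =>
    hd m ((heq ▸ reach (m + 1) j hmj).trans (reach i m him))
  have lt : ∀ m, i + 1 ≤ m → m ≤ j → d (g m) < d (g i) := fun m him =>
    Nat.le_induction (fun h => drop i le_rfl h)
      (fun k hk ih h => (drop k (by omega) h).trans (ih (by omega))) m him
  exact (lt j hij le_rfl).ne (by rw [heq])

theorem stmt2 {V : Type*} (R : V → V → Prop)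
    (h : ∃ f : ℕ → V, InfWalk (Asym (Relation.TransGen R)) f ∧ Function.Injective f) :
    ∃ g : ℕ → V, InfWalk R g ∧ Function.Injective g := by
  obtain ⟨f, hf, -⟩ := h
  let A : V → Prop := fun x => ∃ n, ReflTransGen R x (f n)
  have hA : ∀ x y, R x y → A y → A x := fun x y hxy ⟨n, hn⟩ => ⟨n, hn.head hxy⟩
  have hesc : ∀ x, A x → ∃ k, Escapes R A k x := by
    rintro x ⟨n, hn⟩
    exact exists_escapes hA ⟨n + 1, .refl⟩ (TransGen.trans_right hn (hf n).1) fun hback => by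
      rcases reflTransGen_iff_eq_or_transGen.1 (hback.trans hn) with heq | hlt
      · exact (hf n).2 (by simpa [heq] using (hf n).1)
      · exact (hf n).2 hlt
  let d : V → ℕ := fun x => sInf {k | Escapes R A k x}
  have step : ∀ x : Subtype A, ∃ y : Subtype A,
      R x y ∧ (ReflTransGen R (y : V) x → d y < d x) := by
    rintro ⟨x, hx⟩
    have hmin : Escapes R A (d x) x := Nat.sInf_mem (hesc x hx)
    cases hk : d x with
    | zero => rw [hk] at hmin; exact hmin.elim
    | succ k =>
      rw [hk] at hmin
      obtain ⟨y, hxy, hy, hyx⟩ := hmin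
      exact ⟨⟨y, hy⟩, hxy, fun h => by
        simpa only [hk] using Nat.lt_succ_of_le (Nat.sInf_le (hyx h))⟩
  choose next hnext hdrop using step
  let g : ℕ → Subtype A := fun n => next^[n] ⟨f 0, 0, .refl⟩
  have hg : ∀ n, g (n + 1) = next (g n) := fun n => Function.iterate_succ_apply' _ _ _
  have hwalk : InfWalk R fun n => (g n : V) := fun n => by
    simpa only [hg] using hnext (g n)
  exact ⟨_, hwalk, hwalk.injective_of_rank d fun n => by simpa only [hg] using hdrop (g n)⟩
end

section
/- Let V be a type and Eb, Er binary relations on V such that the asymmetric part of the transitive closure of Eb admits no infinite walk and the asymmetric part of the transitive closure of Er admits no infinite walk. Let Sm ∈ 𝒮 be maximal for the order ≤ = ≤_{Asym(Eb⁺)} (every T ∈ 𝒮 with Sm ≤ T satisfies T = Sm). Then the set Se := {x ∈ V | x ∉ Sm ∧ ¬∃ s ∈ Sm, M x s} is empty; equivalently, every x ∉ Sm satisfies M x s for some s ∈ Sm. -/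
/-- If the asymmetric part of a relation has no infinite walk, every nonempty set
contains an element from which any reachable element of the set can be reached back. -/
theorem exists_forall_rel_symm_of_not_infWalk {V : Type*} (R : V → V → Prop)
    (h : ¬ ∃ f : ℕ → V, InfWalk (Asym R) f) (S : Set V) (hS : S.Nonempty) :
    ∃ x ∈ S, ∀ y ∈ S, R x y → R y x := by
  by_contra! hc
  choose g hgS hg hg' using hc
  obtain ⟨a, ha⟩ := hS
  let F : ℕ → S := fun n => Nat.rec ⟨a, ha⟩ (fun _ p => ⟨g p.1 p.2, hgS p.1 p.2⟩) n
  exact h ⟨fun n => (F n).1, fun n => ⟨hg _ (F n).2, hg' _ (F n).2⟩⟩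

theorem stmt9 {V : Type*} (Eb Er : V → V → Prop)
    (hb : ¬ ∃ f : ℕ → V, InfWalk (Asym (Relation.TransGen Eb)) f)
    (hr : ¬ ∃ f : ℕ → V, InfWalk (Asym (Relation.TransGen Er)) f)
    (Sm : Set V) (hSm : Sm ∈ Scal Eb Er)
    (hmax : ∀ T ∈ Scal Eb Er, leR (Asym (Relation.TransGen Eb)) Sm T → T = Sm) :
    {x : V | x ∉ Sm ∧ ¬ ∃ s ∈ Sm, Mono Eb Er x s} = ∅ := by
  rw [← Set.not_nonempty_iff_eq_empty]
  intro hne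
  obtain ⟨x, ⟨hxS, hxM⟩, hx⟩ := exists_forall_rel_symm_of_not_infWalk _ hr _ hne
  obtain ⟨-, hind, hred⟩ := hSm
  have hT : insert x {s ∈ Sm | ¬ Relation.TransGen Eb s x} = Sm := by
    refine hmax _ ⟨Set.insert_nonempty _ _, ?_, ?_⟩ ?_
    · rintro a (rfl | ⟨ha, hab⟩) b (rfl | ⟨hb', -⟩)
      · exact Or.inl rfl
      · exact Or.inr fun h => hxM ⟨b, hb', h⟩
      · exact Or.inr fun h => h.elim hab fun h => hxM (hred _ ⟨a, ha, h⟩)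
      · exact hind a ha b hb'
    · -- A blue path into a discarded vertex extends to a blue path to `x`.
      have key : ∀ y, ∀ s ∈ Sm, Relation.TransGen Eb y s →
          ∃ s' ∈ insert x {s ∈ Sm | ¬ Relation.TransGen Eb s x}, Mono Eb Er y s' := by
        intro y s hs hys
        by_cases hsx : Relation.TransGen Eb s x
        · exact ⟨x, Set.mem_insert _ _, Or.inl (hys.trans hsx)⟩
        · exact ⟨s, Or.inr ⟨hs, hsx⟩, Or.inl hys⟩
      rintro y ⟨s, rfl | ⟨hs, hsx⟩, hsy⟩
      · by_cases hy : ∃ s' ∈ Sm, Mono Eb Er y s'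
        · obtain ⟨s', hs', h | h⟩ := hy
          · exact key y s' hs' h
          · exact absurd ⟨s', hs', Or.inr (hsy.trans h)⟩ hxM
        · have hyS : y ∉ Sm := fun h => hxM ⟨y, h, Or.inr hsy⟩
          exact ⟨s, Set.mem_insert _ _, Or.inr (hx y ⟨hyS, hy⟩ hsy)⟩
      · obtain ⟨s', hs', h | h⟩ := hred y ⟨s, hs, hsy⟩
        · exact key y s' hs' h
        · obtain rfl : s = s' :=
            (hind s hs s' hs').resolve_right (not_not_intro (Or.inr (hsy.trans h)))
          exact ⟨s, Or.inr ⟨hs, hsx⟩, Or.inr h⟩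
    · intro s hs
      by_cases hsx : Relation.TransGen Eb s x
      · exact ⟨x, Set.mem_insert _ _, Or.inr ⟨hsx, fun h => hxM ⟨s, hs, Or.inl h⟩⟩⟩
      · exact ⟨s, Or.inr ⟨hs, hsx⟩, Or.inl rfl⟩
  exact hxS (hT ▸ Set.mem_insert x _)
end

section
/- Let R be a binary relation on a type V and let x, y, z ∈ V with Asym (R⁺) x y and Asym (R⁺) y z. Then there exist a vertex y' ∈ V and a finite sequence v₀, v₁, …, v_k (k ≥ 2) with v₀ = x, v_k = z, all the vᵢ pairwise distinct, R v_i v_{i+1} for all i < k, y' = v_j for some 0 < j < k, and such that Asym (R⁺) x y' and Asym (R⁺) y' z. That is, two consecutive steps of Asym (R⁺) can be realized by a single duplicate-free R-path passing through an intermediate vertex y' that is itself Asym (R⁺)-between x and z. -/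
/-- The first `k` steps of `v` are `R`-steps. -/
def IsWalk {V : Type*} (R : V → V → Prop) (v : ℕ → V) (k : ℕ) : Prop :=
  ∀ i < k, R (v i) (v (i + 1))

theorem IsWalk.transGen {V : Type*} {R : V → V → Prop} {v : ℕ → V} {k : ℕ}
    (h : IsWalk R v k) {a b : ℕ} (hab : a < b) (hb : b ≤ k) :
    Relation.TransGen R (v a) (v b) := by
  induction b, hab using Nat.le_induction with
  | base => exact .single (h a hb)
  | succ b _ ih => exact (ih (by omega)).tail (h b hb)

theorem exists_isWalk_of_transGen {V : Type*} {R : V → V → Prop} {a b : V}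
    (h : Relation.TransGen R a b) :
    ∃ (v : ℕ → V) (k : ℕ), v 0 = a ∧ v k = b ∧ IsWalk R v k := by
  induction h with
  | single h =>
    refine ⟨fun n => if n = 0 then a else _, 1, rfl, rfl, fun i hi => ?_⟩
    obtain rfl : i = 0 := by omega
    exact h
  | @tail b c _ hbc ih =>
    obtain ⟨v, k, h0, hk, hv⟩ := ih
    refine ⟨fun n => if n ≤ k then v n else c, k + 1, by simpa using h0, by simp, fun i hi => ?_⟩
    rcases Nat.lt_succ_iff_lt_or_eq.1 hi with hi | rfl
    · simpa [hi.le, Nat.succ_le_of_lt hi] using hv i hi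
    · simpa [hk] using hbc

/-- Following `v` for `a` steps and then `w` gives a walk. -/
theorem IsWalk.append {V : Type*} {R : V → V → Prop} {v w : ℕ → V} {a b : ℕ}
    (hv : IsWalk R v a) (hw : IsWalk R w b) (h : v a = w 0) :
    IsWalk R (fun n => if n ≤ a then v n else w (n - a)) (a + b) := by
  intro i hi
  rcases lt_trichotomy i a with hia | rfl | hia
  · simpa [hia.le, Nat.succ_le_of_lt hia] using hv i hia
  · simpa [h] using hw 0 (by omega)
  · have h1 : ¬ i ≤ a := by omega
    have h2 : ¬ i + 1 ≤ a := by omega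
    have h3 : i + 1 - a = i - a + 1 := by omega
    simpa only [h1, h2, h3, if_false] using hw (i - a) (by omega)

/-- There is a walk of length `k` from `x` to `z` visiting a vertex strictly between them
for the asymmetric part of the transitive closure. -/
def HasWalkBetween {V : Type*} (R : V → V → Prop) (x z : V) (k : ℕ) : Prop :=
  ∃ v : ℕ → V, v 0 = x ∧ v k = z ∧ IsWalk R v k ∧
    ∃ m ≤ k, Asym (Relation.TransGen R) x (v m) ∧ Asym (Relation.TransGen R) (v m) z

theorem exists_hasWalkBetween {V : Type*} {R : V → V → Prop} {x y z : V}
    (hxy : Asym (Relation.TransGen R) x y) (hyz : Asym (Relation.TransGen R) y z) :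
    ∃ k, HasWalkBetween R x z k := by
  obtain ⟨v, a, hv0, hva, hv⟩ := exists_isWalk_of_transGen hxy.1
  obtain ⟨w, b, hw0, hwb, hw⟩ := exists_isWalk_of_transGen hyz.1
  refine ⟨a + b, _, by simpa using hv0, ?_, hv.append hw (hva.trans hw0.symm), a, by omega, ?_⟩
  · rcases Nat.eq_zero_or_pos b with rfl | hb
    · simp [hva, ← hwb, hw0]
    · simp [hwb, hb.ne']
  · simpa [hva] using ⟨hxy, hyz⟩

/-- A strictly intermediate vertex may be replaced by any vertex mutually reachable with it. -/
theorem asym_transGen_of_mutually_reachable {V : Type*} {R : V → V → Prop} {x y u z : V}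
    (hxy : Asym (Relation.TransGen R) x y) (hyz : Asym (Relation.TransGen R) y z)
    (hyu : Relation.TransGen R y u) (huy : Relation.TransGen R u y) :
    Asym (Relation.TransGen R) x u ∧ Asym (Relation.TransGen R) u z :=
  ⟨⟨hxy.1.trans hyu, fun h => hxy.2 (hyu.trans h)⟩,
    ⟨huy.trans hyz.1, fun h => hyz.2 (h.trans huy)⟩⟩

/-- Cutting out a closed subwalk leaves a walk visiting a strictly intermediate vertex. -/
theorem HasWalkBetween.of_cut {V : Type*} {R : V → V → Prop} {x z : V} {v : ℕ → V}
    {k i j m : ℕ} (h0 : v 0 = x) (hk : v k = z) (hv : IsWalk R v k) (hm : m ≤ k)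
    (hxm : Asym (Relation.TransGen R) x (v m)) (hmz : Asym (Relation.TransGen R) (v m) z)
    (hij : i < j) (hjk : j ≤ k) (h : v i = v j) :
    HasWalkBetween R x z (i + (k - j)) := by
  have hvi : IsWalk R v i := fun n hn => hv n (by omega)
  have hvj : IsWalk R (fun n => v (j + n)) (k - j) := fun n hn => hv (j + n) (by omega)
  refine ⟨_, by simpa using h0, ?_, hvi.append hvj h, ?_⟩
  · by_cases hj : k - j = 0
    · obtain rfl : j = k := by omega
      simp [h, hk]
    · simp [hj, Nat.add_sub_cancel' hjk, hk]
  · rcases le_or_gt m i with hmi | hmi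
    · exact ⟨m, by omega, by simpa [hmi] using ⟨hxm, hmz⟩⟩
    rcases lt_or_ge m j with hmj | hmj
    · refine ⟨i, by omega, ?_⟩
      simpa using asym_transGen_of_mutually_reachable hxm hmz
        (h ▸ hv.transGen hmj hjk) (hv.transGen hmi hm)
    · rcases hmj.eq_or_lt with rfl | hmj
      · exact ⟨i, by omega, by simpa [h] using ⟨hxm, hmz⟩⟩
      · refine ⟨i + (m - j), by omega, ?_⟩
        have h1 : ¬ m - j = 0 := by omega
        simpa [h1, Nat.add_sub_cancel' hmj.le] using ⟨hxm, hmz⟩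

theorem stmt12 {V : Type*} (R : V → V → Prop) (x y z : V)
    (hxy : Asym (Relation.TransGen R) x y)
    (hyz : Asym (Relation.TransGen R) y z) :
    ∃ (y' : V) (k : ℕ), 2 ≤ k ∧ ∃ v : ℕ → V, v 0 = x ∧ v k = z ∧
      (∀ i ≤ k, ∀ j ≤ k, v i = v j → i = j) ∧
      (∀ i < k, R (v i) (v (i + 1))) ∧
      (∃ j, 0 < j ∧ j < k ∧ y' = v j) ∧
      Asym (Relation.TransGen R) x y' ∧ Asym (Relation.TransGen R) y' z := by
  classical
  have hex := exists_hasWalkBetween hxy hyz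
  obtain ⟨v, h0, hk, hv, m, hm, hxm, hmz⟩ := Nat.find_spec hex
  have hmin : ∀ l, HasWalkBetween R x z l → Nat.find hex ≤ l := fun l => Nat.find_min' hex
  generalize Nat.find hex = k at *
  have hm0 : 0 < m := by
    rcases Nat.eq_zero_or_pos m with rfl | hm0
    · exact absurd (h0 ▸ hxm.1) (h0 ▸ hxm.2)
    · exact hm0
  have hmk : m < k := by
    rcases hm.eq_or_lt with rfl | hmk
    · exact absurd (hk ▸ hmz.1) (hk ▸ hmz.2)
    · exact hmk
  have hinj : ∀ i j, i < j → j ≤ k → v i ≠ v j := fun i j hij hjk h => by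
    have := hmin _ (.of_cut h0 hk hv hm hxm hmz hij hjk h)
    omega
  refine ⟨v m, k, by omega, v, h0, hk, fun i hi j hj h => ?_, hv, ⟨m, hm0, hmk, rfl⟩, hxm, hmz⟩
  rcases lt_trichotomy i j with hij | hij | hij
  · exact absurd h (hinj i j hij hj)
  · exact hij
  · exact absurd h.symm (hinj j i hij hi)
end

section
/- (Kernel corollary, finite case.) Let V be a nonempty finite type and let Eb and Er be transitive binary relations on V (a finite digraph whose edges are colored with two colors, each color class being transitive). Then the digraph admits a kernel: there exists a set S ⊆ V such that for all x, y ∈ S, x = y or ¬(Eb x y ∨ Er x y) (S is independent), and every x ∉ S satisfies Eb x s or Er x s for some s ∈ S (S is absorbing). -/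
theorem Transitive.asym {V : Type*} {R : V → V → Prop} (hR : Transitive R) :
    Transitive (Asym R) :=
  fun _ _ _ hxy hyz => ⟨hR hxy.1 hyz.1, fun hzx => hxy.2 (hR hyz.1 hzx)⟩

theorem Transitive.leR {V : Type*} {R : V → V → Prop} (hR : Transitive R) :
    Transitive (leR R) := by
  intro S T U hST hTU s hs
  obtain ⟨t, ht, hst⟩ := hST s hs
  obtain ⟨u, hu, htu⟩ := hTU t ht
  refine ⟨u, hu, ?_⟩
  rcases hst with rfl | hst
  · exact htu
  · rcases htu with rfl | htu
    · exact Or.inr hst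
    · exact Or.inr (hR hst htu)

/-- A transitive relation on a finite type has a maximal element in every nonempty set. -/
theorem Transitive.exists_maximal {V : Type*} [Finite V] {R : V → V → Prop}
    (hR : Transitive R) {A : Set V} (hA : A.Nonempty) :
    ∃ m ∈ A, ∀ y ∈ A, R m y → R y m := by
  have : IsTrans V (Function.swap (Asym R)) := ⟨fun _ _ _ hxy hyz => hR.asym hyz hxy⟩
  have : Std.Irrefl (Function.swap (Asym R)) := ⟨fun _ h => h.2 h.1⟩
  obtain ⟨m, hm, hmax⟩ :=
    (Finite.wellFounded_of_trans_of_irrefl (Function.swap (Asym R))).has_min A hA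
  exact ⟨m, hm, fun y hy hmy => by_contra fun hym => hmax y hy ⟨hmy, hym⟩⟩

/-- `S` is independent, and every red out-neighbour of `S` has an edge into `S`. -/
structure IsSemikernel {V : Type*} (Eb Er : V → V → Prop) (S : Set V) : Prop where
  indep : Indep (fun x y => Eb x y ∨ Er x y) S
  returns : ∀ s ∈ S, ∀ y, Er s y → ∃ t ∈ S, Eb y t ∨ Er y t

/-- Adding to a semikernel a vertex `x` with no edge into it, chosen red-maximal among such
vertices, and deleting the blue in-neighbours of `x` gives a semikernel. -/
theorem IsSemikernel.exchange {V : Type*} {Eb Er : V → V → Prop} (hb : Transitive Eb)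
    (hr : Transitive Er) {S : Set V} (hS : IsSemikernel Eb Er S) {x : V}
    (hx : ∀ s ∈ S, ¬ (Eb x s ∨ Er x s))
    (hmax : ∀ y, y ∉ S → (∀ s ∈ S, ¬ (Eb y s ∨ Er y s)) → Er x y → Er y x) :
    IsSemikernel Eb Er (insert x {s ∈ S | ¬ Eb s x}) := by
  have redirect : ∀ y, ∀ t ∈ S, (Eb y t ∨ Er y t) → (Er y t → ¬ Eb t x) →
      ∃ t ∈ insert x {s ∈ S | ¬ Eb s x}, Eb y t ∨ Er y t := by
    intro y t ht hyt hred
    by_cases htx : Eb t x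
    · rcases hyt with hyt | hyt
      · exact ⟨x, Or.inl rfl, Or.inl (hb hyt htx)⟩
      · exact absurd htx (hred hyt)
    · exact ⟨t, Or.inr ⟨ht, htx⟩, hyt⟩
  constructor
  · rintro u (rfl | ⟨hu, hux⟩) v (rfl | ⟨hv, hvx⟩)
    · exact Or.inl rfl
    · exact Or.inr (hx v hv)
    · refine Or.inr ?_
      rintro (h | h)
      · exact hux h
      · obtain ⟨t, ht, hvt⟩ := hS.returns u hu v h
        exact hx t ht hvt
    · exact hS.indep u hu v hv
  · rintro s (rfl | ⟨hs, hsx⟩) y hsy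
    · by_cases hy : ∃ t ∈ S, Eb y t ∨ Er y t
      · obtain ⟨t, ht, hyt⟩ := hy
        exact redirect y t ht hyt fun h => absurd (Or.inr (hr hsy h)) (hx t ht)
      · push Not at hy
        refine ⟨s, Or.inl rfl, Or.inr (hmax y ?_ ?_ hsy)⟩
        · exact fun hyS => hx y hyS (Or.inr hsy)
        · exact fun t ht => not_or.mpr (hy t ht)
    · obtain ⟨t, ht, hyt⟩ := hS.returns s hs y hsy
      refine redirect y t ht hyt fun h => ?_
      rcases hS.indep s hs t ht with rfl | hst
      · exact hsx
      · exact absurd (Or.inr (hr hsy h)) hst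

theorem stmt15 {V : Type*} [Nonempty V] [Finite V] (Eb Er : V → V → Prop)
    (hb : Transitive Eb) (hr : Transitive Er) :
    ∃ S : Set V,
      (∀ x ∈ S, ∀ y ∈ S, x = y ∨ ¬ (Eb x y ∨ Er x y)) ∧
      (∀ x : V, x ∉ S → ∃ s ∈ S, Eb x s ∨ Er x s) := by
  have hempty : IsSemikernel Eb Er ∅ := ⟨by simp [Indep], by simp⟩
  obtain ⟨S, hS, hSmax⟩ := hb.asym.leR.exists_maximal
    (A := {S | IsSemikernel Eb Er S}) ⟨∅, hempty⟩
  refine ⟨S, hS.indep, ?_⟩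
  by_contra! hne
  obtain ⟨z, hzS, hz⟩ := hne
  obtain ⟨x, ⟨hxS, hx⟩, hxmax⟩ := hr.exists_maximal
    (A := {x | x ∉ S ∧ ∀ s ∈ S, ¬ (Eb x s ∨ Er x s)})
    ⟨z, hzS, fun s hs => not_or.mpr (hz s hs)⟩
  have hle : leR (Asym Eb) S (insert x {s ∈ S | ¬ Eb s x}) := by
    intro s hs
    by_cases hsx : Eb s x
    · exact ⟨x, Or.inl rfl, Or.inr ⟨hsx, fun h => hx s hs (Or.inl h)⟩⟩
    · exact ⟨s, Or.inr ⟨hs, hsx⟩, Or.inl rfl⟩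
  obtain ⟨t, ht, rfl | hxt⟩ := hSmax _
    (hS.exchange hb hr hx fun y hyS hy => hxmax y ⟨hyS, hy⟩) hle x (Or.inl rfl)
  · exact hxS ht
  · exact hx t ht (Or.inl hxt.1)
end
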